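/- arXiv:1705.04205 — 6 statements merged into one kernel-verified Lean document; each statement's English description precedes it below -/
import Mathlib

section
/- For every ε ∈ (0,1) there exists a constant C such that the following holds: for every integer k ≥ 2 and every n with 3·k·C ≤ √n, and every balanced-blocks partition of {0,1}^n into 3k blocks with associated balanced-blocks function BB, every k-monotone function g : (Fin n → Bool) → Bool satisfies d(BB, g) ≥ (1 − ε)·(k − 1)/(3k). -/
/-- A point of the hypercube `{0,1}^n`. -/
abbrev Pt (n : ℕ) := Fin n → Bool

/-- The weight `|x|` of a point: the number of coordinates set to `true`. -/
def wt {n : ℕ} (x : Pt n) : ℕ := (Finset.univ.filter (fun i => x i = true)).card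

/-- The partial order `x ≼ y` on the hypercube. -/
def ple {n : ℕ} (x y : Pt n) : Prop := ∀ i, x i ≤ y i

/-- The strict order `x ≺ y` on the hypercube. -/
def plt {n : ℕ} (x y : Pt n) : Prop := ple x y ∧ x ≠ y

/-- `f` is `k`-monotone: there is no chain `x 0 ≺ x 1 ≺ ⋯ ≺ x k` with
`f (x 0) = true` and `f` alternating along the chain. -/
def IsKMono {n : ℕ} (k : ℕ) (f : Pt n → Bool) : Prop :=
  ¬ ∃ x : ℕ → Pt n, (∀ i < k, plt (x i) (x (i + 1))) ∧ f (x 0) = true ∧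
      ∀ i < k, f (x i) ≠ f (x (i + 1))

/-- The normalized Hamming distance `d(f,g)`. -/
noncomputable def hdist {n : ℕ} (f g : Pt n → Bool) : ℝ :=
  ({x : Pt n | f x ≠ g x}.ncard : ℝ) / 2 ^ n

/-- `b : ℕ → ℕ` describes a balanced-blocks partition of `{0,1}^m` into `ℓ` blocks:
the `i`-th interval of levels (0-indexed) is `I_{i+1} = [b i, b (i+1))`, these intervals
are nonempty and partition `{0,…,m}`, and each block
`B_{i+1} = {y : b i ≤ |y| < b (i+1)}` has size within a `(1 ± ℓ/√m)` factor of `2^m/ℓ`. -/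
def IsBBPartition (m ℓ : ℕ) (b : ℕ → ℕ) : Prop :=
  b 0 = 0 ∧ b ℓ = m + 1 ∧ (∀ i < ℓ, b i < b (i + 1)) ∧
  ∀ i < ℓ,
    (1 - ℓ / Real.sqrt m) * 2 ^ m / ℓ ≤
        ({y : Pt m | b i ≤ wt y ∧ wt y < b (i + 1)}.ncard : ℝ) ∧
    ({y : Pt m | b i ≤ wt y ∧ wt y < b (i + 1)}.ncard : ℝ) ≤
        (1 + ℓ / Real.sqrt m) * 2 ^ m / ℓ

/-- `BB` is the balanced-blocks function associated to the partition `b`: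
it is `true` exactly on the blocks `B_i` with `i` odd (1-indexed), i.e. those whose
0-indexed position is even. -/
def IsBBFun (m ℓ : ℕ) (b : ℕ → ℕ) (BB : Pt m → Bool) : Prop :=
  ∀ y : Pt m, BB y = true ↔ ∃ i < ℓ, Even i ∧ b i ≤ wt y ∧ wt y < b (i + 1)

/-- The weight `w` belongs to `MID_L`, i.e. `|w - n_L/2| ≤ √n_L/100`. -/
def midL (nL w : ℕ) : Prop := |(w : ℝ) - nL / 2| ≤ Real.sqrt nL / 100

/-- The weight of `z` restricted to the first `nL` coordinates (the set `L`). -/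
def wL {n : ℕ} (nL : ℕ) (z : Pt n) : ℕ :=
  (Finset.univ.filter (fun i : Fin n => (i : ℕ) < nL ∧ z i = true)).card

/-- The weight of `z` restricted to the coordinates of index `≥ nL` (the set `R`). -/
def wR {n : ℕ} (nL : ℕ) (z : Pt n) : ℕ :=
  (Finset.univ.filter (fun i : Fin n => nL ≤ (i : ℕ) ∧ z i = true)).card

/-- The restriction of `z : Pt n` to the last `nR` coordinates, given `nL + nR = n`. -/
def yPart {n : ℕ} (nL nR : ℕ) (h : nL + nR = n) (z : Pt n) : Pt nR :=
  fun j => z ⟨nL + (j : ℕ), by have hj := j.isLt; omega⟩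

/-- `f` is the hard function built from `BB : Pt nR → Bool`: writing `z = (x,y)` with
`x` the first `nL` coordinates and `y` the last `nR` coordinates, `f z = BB y` when
`|x| ∈ MID_L`, and `f z = false` otherwise. -/
def IsHardFun {n : ℕ} (nL nR : ℕ) (h : nL + nR = n) (BB : Pt nR → Bool)
    (f : Pt n → Bool) : Prop :=
  ∀ z : Pt n,
    (midL nL (wL nL z) → f z = BB (yPart nL nR h z)) ∧
    (¬ midL nL (wL nL z) → f z = false)

/-- The maximal chain generated by a permutation `σ`: `z_i(j) = decide (σ⁻¹ j < i)`. -/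
def chainOf {n : ℕ} (σ : Equiv.Perm (Fin n)) : ℕ → Pt n :=
  fun i j => decide ((σ.symm j : ℕ) < i)

/-- `Z 0 ≺ Z 1 ≺ ⋯ ≺ Z n` is a maximal chain in `{0,1}^n`
(so `Z 0 = 0ⁿ`, `Z n = 1ⁿ` and `|Z i| = i`). -/
def IsFullChain {n : ℕ} (Z : ℕ → Pt n) : Prop :=
  (∀ i < n, plt (Z i) (Z (i + 1))) ∧ ∀ i ≤ n, wt (Z i) = i

/-- The chain `Z 0 ≺ ⋯ ≺ Z n` contains a violation of `k`-monotonicity of `f`: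
some `k+1` of its points form such a violation. -/
def ChainViol {n : ℕ} (k : ℕ) (f : Pt n → Bool) (Z : ℕ → Pt n) : Prop :=
  ∃ t : ℕ → ℕ, (∀ i < k, t i < t (i + 1)) ∧ (∀ i ≤ k, t i ≤ n) ∧
    f (Z (t 0)) = true ∧ ∀ i < k, f (Z (t i)) ≠ f (Z (t (i + 1)))

/-- The probability, over a uniformly random permutation `σ` of `Fin n`
(equivalently, a uniformly random maximal chain `chainOf σ`), of the event `P`. -/
noncomputable def permProb (n : ℕ) (P : Equiv.Perm (Fin n) → Prop) : ℝ :=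
  ({σ : Equiv.Perm (Fin n) | P σ}.ncard : ℝ) / Nat.factorial n

/-- The set `V(Z)`: all `j` such that some point `z = (x,y)` on the chain `Z`
has `|x| ∈ MID_L` and `|y| = j`. -/
def VSet {n : ℕ} (nL : ℕ) (Z : ℕ → Pt n) : Set ℕ :=
  {j | ∃ i ≤ n, midL nL (wL nL (Z i)) ∧ wR nL (Z i) = j}

/-- The point whose first `j` coordinates are `true` and whose other coordinates are `false`. -/
def initialPt (n j : ℕ) : Pt n := fun i => decide ((i : ℕ) < j)

lemma wt_comp_perm {n : ℕ} (x : Pt n) (π : Equiv.Perm (Fin n)) : wt (x ∘ π) = wt x := by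
  unfold wt
  refine Finset.card_bij (fun i _ => π i) (by simp) (fun _ _ _ _ h => π.injective h) ?_
  intro i hi
  exact ⟨π.symm i, by simpa using hi, by simp⟩

lemma wt_initialPt {n j : ℕ} (hj : j ≤ n) : wt (initialPt n j) = j := by
  unfold wt initialPt
  simp [Fin.card_filter_val_lt, hj]

lemma wt_le {n : ℕ} (x : Pt n) : wt x ≤ n := by
  simpa [wt] using Finset.card_le_univ (Finset.univ.filter fun i => x i = true)

/-- Points of equal weight lie in one orbit of the symmetric group. -/
lemma exists_perm_of_wt_eq {n : ℕ} {x y : Pt n} (h : wt x = wt y) :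
    ∃ τ : Equiv.Perm (Fin n), x = y ∘ τ := by
  have hc : Fintype.card {i // x i = true} = Fintype.card {i // y i = true} := by
    rw [Fintype.card_subtype, Fintype.card_subtype]
    exact h
  let e : {i // x i = true} ≃ {i // y i = true} := Fintype.equivOfCardEq hc
  refine ⟨e.extendSubtype, funext fun i => ?_⟩
  by_cases hi : x i = true
  · have : y (e.extendSubtype i) = true := e.extendSubtype_mem i hi
    rw [hi, Function.comp_apply, this]
  · have := e.extendSubtype_not_mem i hi
    simp only [Bool.not_eq_true] at hi this
    rw [hi, Function.comp_apply, this]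

/-- Summing over the cube is the same as averaging over the maximal chains the sum over the
points of the chain, each weighted by the size of its level. -/
lemma factorial_mul_sum {n : ℕ} (F : Pt n → ℕ) :
    n.factorial * ∑ x, F x =
      ∑ π : Equiv.Perm (Fin n), ∑ x : Pt n, F (initialPt n (wt x) ∘ π) := by
  have hperm (π : Equiv.Perm (Fin n)) : ∑ x : Pt n, F (x ∘ π) = ∑ x, F x :=
    (Equiv.arrowCongr π.symm (Equiv.refl Bool)).sum_comp F
  have horbit (x : Pt n) : ∑ π : Equiv.Perm (Fin n), F (initialPt n (wt x) ∘ π) =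
      ∑ π : Equiv.Perm (Fin n), F (x ∘ π) := by
    obtain ⟨τ, hτ⟩ := exists_perm_of_wt_eq (wt_initialPt (wt_le x))
    rw [hτ]
    exact Equiv.sum_comp (Equiv.mulLeft τ) fun π : Equiv.Perm (Fin n) => F (x ∘ π)
  rw [Finset.sum_comm, Finset.sum_congr rfl fun x _ => horbit x, Finset.sum_comm,
    Finset.sum_congr rfl fun π _ => hperm π]
  simp [Fintype.card_perm]

lemma plt_initialPt_comp {n i j : ℕ} (π : Equiv.Perm (Fin n)) (hij : i < j) (hj : j ≤ n) :
    plt (initialPt n i ∘ π) (initialPt n j ∘ π) := by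
  refine ⟨fun l => ?_, fun h => ?_⟩
  · simp only [initialPt, Function.comp_apply, Bool.le_iff_imp, decide_eq_true_eq]
    omega
  · have := congrArg wt h
    rw [wt_comp_perm, wt_comp_perm, wt_initialPt hj, wt_initialPt (by omega)] at this
    omega

/-- A Boolean sequence has an alternating subsequence with as many changes as the sequence. -/
lemma exists_alternating (h : ℕ → Bool) (M : ℕ) :
    ∃ t : ℕ → ℕ,
      (∀ i < ((Finset.range M).filter fun i => h i ≠ h (i + 1)).card,
        t i < t (i + 1) ∧ h (t i) ≠ h (t (i + 1))) ∧
      (∀ i ≤ ((Finset.range M).filter fun i => h i ≠ h (i + 1)).card, t i ≤ M) ∧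
      h (t ((Finset.range M).filter fun i => h i ≠ h (i + 1)).card) = h M := by
  induction M with
  | zero => exact ⟨fun _ => 0, by simp⟩
  | succ M ih =>
    obtain ⟨t, h1, h2, h3⟩ := ih
    rw [Finset.range_add_one, Finset.filter_insert]
    by_cases hM : h M = h (M + 1)
    · rw [if_neg (by simpa using hM)]
      exact ⟨t, h1, fun i hi => (h2 i hi).trans (Nat.le_succ M), h3.trans hM⟩
    · rw [if_pos hM, Finset.card_insert_of_notMem (by simp)]
      set r := ((Finset.range M).filter fun i => h i ≠ h (i + 1)).card
      refine ⟨fun i => if i ≤ r then t i else M + 1, fun i hi => ?_, fun i hi => ?_, ?_⟩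
      · rcases Nat.lt_succ_iff_lt_or_eq.mp hi with hi | rfl
        · simpa [hi.le, Nat.succ_le_of_lt hi] using h1 i hi
        · simpa [h3, hM, Nat.lt_succ_iff] using h2 _ le_rfl
      · dsimp only
        split_ifs with hir
        · exact (h2 i hir).trans (Nat.le_succ M)
        · exact le_rfl
      · simp

/-- A sequence that differs from an alternating one in few places changes value often. -/
lemma le_card_changes_add (h : ℕ → Bool) (e : ℕ → Prop) [DecidablePred e] (M : ℕ)
    (he : ∀ i ≤ M, e i ↔ ¬ (h i = true ↔ Even i)) :
    M + (if e M then 1 else 0) ≤ ((Finset.range M).filter fun i => h i ≠ h (i + 1)).card +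
      2 * ((Finset.range (M + 1)).filter e).card := by
  induction M with
  | zero => by_cases h0 : e 0 <;> simp [Finset.filter_singleton, h0]
  | succ M ih =>
    have ih := ih fun i hi => he i (hi.trans (Nat.le_succ M))
    have hM := he M (Nat.le_succ M)
    have hM' := he (M + 1) le_rfl
    rw [Finset.range_add_one (n := M + 1), Finset.filter_insert,
      Finset.range_add_one (n := M), Finset.filter_insert]
    rw [Finset.range_add_one (n := M)] at ih
    by_cases h1 : e (M + 1)
    · rw [if_pos h1, if_pos h1, Finset.card_insert_of_notMem (by simp)]
      by_cases h0 : e M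
      · have hne : h M ≠ h (M + 1) := by
          rw [Nat.even_add_one] at hM'
          cases hh : h M <;> cases hh' : h (M + 1) <;> simp_all
        rw [if_pos h0] at ih
        rw [if_pos hne, Finset.card_insert_of_notMem (by simp)]
        omega
      · rw [if_neg h0] at ih
        split_ifs
        · rw [Finset.card_insert_of_notMem (by simp)]
          omega
        · omega
    · rw [if_neg h1, if_neg h1]
      by_cases h0 : e M
      · rw [if_pos h0] at ih
        refine ih.trans (Nat.add_le_add_right (Finset.card_le_card ?_) _)
        split_ifs
        · exact Finset.subset_insert _ _
        · exact subset_rfl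
      · have hne : h M ≠ h (M + 1) := by
          rw [Nat.even_add_one] at hM'
          cases hh : h M <;> cases hh' : h (M + 1) <;> simp_all
        rw [if_neg h0] at ih
        rw [if_pos hne, Finset.card_insert_of_notMem (by simp)]
        omega

/-- Along a chain, a `k`-monotone function changes value at most `k` times. -/
lemma IsKMono.card_changes_le {n k M : ℕ} {g : Pt n → Bool} (hg : IsKMono k g) (y : ℕ → Pt n)
    (hy : ∀ i j, i < j → j ≤ M → plt (y i) (y j)) :
    ((Finset.range M).filter fun i => g (y i) ≠ g (y (i + 1))).card ≤ k := by
  by_contra! hk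
  obtain ⟨t, h1, h2, -⟩ := exists_alternating (fun i => g (y i)) M
  apply hg
  cases h0 : g (y (t 0)) with
  | true =>
    exact ⟨fun i => y (t i),
      fun i hi => hy _ _ (h1 i (by omega)).1 (h2 _ (by omega)), h0,
      fun i hi => (h1 i (by omega)).2⟩
  | false =>
    refine ⟨fun i => y (t (i + 1)),
      fun i hi => hy _ _ (h1 (i + 1) (by omega)).1 (h2 _ (by omega)), ?_,
      fun i hi => (h1 (i + 1) (by omega)).2⟩
    have := (h1 0 (by omega)).2
    simpa [h0] using this

/-- Consecutive blocks are ordered. -/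
lemma block_mono {ℓ : ℕ} {b : ℕ → ℕ} (hb : ∀ i < ℓ, b i < b (i + 1)) {i j : ℕ} (hij : i < j)
    (hj : j ≤ ℓ) : b (i + 1) ≤ b j := by
  induction j, hij using Nat.le_induction with
  | base => exact le_rfl
  | succ j hij ih => exact (ih (by omega)).trans (hb j (by omega)).le

lemma block_unique {ℓ : ℕ} {b : ℕ → ℕ} (hb : ∀ i < ℓ, b i < b (i + 1)) {i j w : ℕ}
    (hi : i < ℓ) (hj : j < ℓ) (hwi : b i ≤ w ∧ w < b (i + 1)) (hwj : b j ≤ w ∧ w < b (j + 1)) :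
    i = j := by
  rcases lt_trichotomy i j with h | h | h
  · have := block_mono hb h hj.le
    omega
  · exact h
  · have := block_mono hb h hi.le
    omega

/-- On every maximal chain, a `k`-monotone function is wrong throughout at least `k` of the
`3k` blocks. -/
lemma le_card_wrong_blocks {n k : ℕ} (hk : 1 ≤ k) {b : ℕ → ℕ} {BB g : Pt n → Bool}
    (hb : ∀ i < 3 * k, b i < b (i + 1)) (hn : b (3 * k) = n + 1)
    (hBB : IsBBFun n (3 * k) b BB) (hg : IsKMono k g) (π : Equiv.Perm (Fin n)) :
    k ≤ ((Finset.range (3 * k)).filter fun i => ∀ w, b i ≤ w → w < b (i + 1) →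
      BB (initialPt n w ∘ π) ≠ g (initialPt n w ∘ π)).card := by
  set e : ℕ → Prop := fun i => ∀ w, b i ≤ w → w < b (i + 1) →
    BB (initialPt n w ∘ π) ≠ g (initialPt n w ∘ π) with he
  have hlt {i w : ℕ} (hi : i < 3 * k) (hw : w < b (i + 1)) : w ≤ n := by
    have := block_mono hb (lt_of_lt_of_le (Nat.lt_succ_self i) (Nat.succ_le_of_lt hi)) le_rfl
    omega
  have hcolor {i w : ℕ} (hi : i < 3 * k) (hw : b i ≤ w ∧ w < b (i + 1)) :
      BB (initialPt n w ∘ π) = true ↔ Even i := by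
    rw [hBB, wt_comp_perm, wt_initialPt (hlt hi hw.2)]
    refine ⟨?_, fun h => ⟨i, hi, h, hw⟩⟩
    rintro ⟨j, hj, hev, hwj⟩
    rwa [block_unique hb hi hj hw hwj]
  have hrep (i : ℕ) : ∃ w, i < 3 * k → (b i ≤ w ∧ w < b (i + 1)) ∧
      (e i ↔ BB (initialPt n w ∘ π) ≠ g (initialPt n w ∘ π)) := by
    by_cases hi : e i
    · exact ⟨b i, fun hik => ⟨⟨le_rfl, hb i hik⟩, fun _ => hi _ le_rfl (hb i hik), fun _ => hi⟩⟩
    · have hi' := hi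
      simp only [he] at hi'
      push Not at hi'
      obtain ⟨w, h1, h2, h3⟩ := hi'
      exact ⟨w, fun _ => ⟨⟨h1, h2⟩, fun h => absurd h hi, fun h => absurd h3 h⟩⟩
  choose p hp using hrep
  have hchanges := hg.card_changes_le (M := 3 * k - 1) (fun i => initialPt n (p i) ∘ π) (by
    intro i j hij hj
    have hpi := (hp i (by omega)).1
    have hpj := (hp j (by omega)).1
    have := block_mono hb hij (by omega)
    exact plt_initialPt_comp π (by omega) (hlt (by omega) hpj.2))
  have hcount := le_card_changes_add (fun i => g (initialPt n (p i) ∘ π)) e (3 * k - 1) (by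
    intro i hi
    obtain ⟨hpi, hei⟩ := hp i (by omega)
    rw [hei, ← hcolor (by omega) hpi, ne_eq, Bool.eq_iff_iff,
      iff_comm (a := g _ = true)])
  have hlen : 3 * k - 1 + 1 = 3 * k := by omega
  simp only [hlen] at hcount
  change k ≤ ((Finset.range (3 * k)).filter e).card
  split_ifs at hcount <;> omega

/-- For every `ε ∈ (0,1)` there is a constant `C` such that for every
integer `k ≥ 2` and every `n` with `3·k·C ≤ √n`, and every balanced-blocks partition of
`{0,1}^n` into `3k` blocks with associated function `BB`, every `k`-monotone
`g : Pt n → Bool` satisfies `d(BB, g) ≥ (1 − ε)·(k − 1)/(3k)`. -/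
theorem stmt5 (ε : ℝ) (hε0 : 0 < ε) (hε1 : ε < 1) :
    ∃ C : ℝ, ∀ (k n : ℕ), 2 ≤ k → (3 * (k : ℝ) * C ≤ Real.sqrt n) →
      ∀ (b : ℕ → ℕ) (BB : Pt n → Bool),
        IsBBPartition n (3 * k) b → IsBBFun n (3 * k) b BB →
        ∀ g : Pt n → Bool, IsKMono k g →
          (1 - ε) * ((k : ℝ) - 1) / (3 * k) ≤ hdist BB g := by
  refine ⟨1 / ε, fun k n hk hC b BB hpart hBB g hg => ?_⟩
  obtain ⟨-, hn, hb, hsize⟩ := hpart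
  have hk0 : (0 : ℝ) < k := by
    exact_mod_cast (by omega : 0 < k)
  have hsqrt : 0 < Real.sqrt n := lt_of_lt_of_le (by positivity) hC
  have hratio : ((3 * k : ℕ) : ℝ) / Real.sqrt n ≤ ε := by
    rw [div_le_iff₀ hsqrt]
    push_cast
    rwa [mul_one_div, div_le_iff₀' hε0] at hC
  set m : ℝ := (1 - ε) * 2 ^ n / (3 * k) with hm
  have hm0 : 0 ≤ m := by
    have : 0 ≤ 1 - ε := by linarith
    positivity
  let block (i : ℕ) : Finset (Pt n) := Finset.univ.filter fun y => b i ≤ wt y ∧ wt y < b (i + 1)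
  have hblock : ∀ i < 3 * k, m ≤ (block i).card := by
    intro i hi
    have h := (hsize i hi).1
    rw [Set.ncard_eq_toFinset_card', Set.toFinset_ofPred] at h
    refine le_trans ?_ h
    rw [hm, Nat.cast_mul, Nat.cast_ofNat]
    rw [Nat.cast_mul, Nat.cast_ofNat] at hratio
    gcongr
  have hchain (π : Equiv.Perm (Fin n)) : k * m ≤ ((∑ x : Pt n,
      if BB (initialPt n (wt x) ∘ π) ≠ g (initialPt n (wt x) ∘ π) then 1 else 0 : ℕ) : ℝ) := by
    have hwrong := le_card_wrong_blocks (by omega) hb hn hBB hg π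
    set W := (Finset.range (3 * k)).filter fun i => ∀ w, b i ≤ w → w < b (i + 1) →
      BB (initialPt n w ∘ π) ≠ g (initialPt n w ∘ π) with hW
    have hmem {i : ℕ} (hi : i ∈ W) : i < 3 * k := by
      simpa using (Finset.mem_filter.mp hi).1
    have hdisj : (W : Set ℕ).PairwiseDisjoint block := by
      intro i hi j hj hij
      refine Finset.disjoint_left.mpr fun x hxi hxj => hij ?_
      exact block_unique hb (hmem hi) (hmem hj) (by simpa [block] using hxi)
        (by simpa [block] using hxj)
    have hsub : W.biUnion block ⊆ Finset.univ.filter fun x : Pt n =>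
        BB (initialPt n (wt x) ∘ π) ≠ g (initialPt n (wt x) ∘ π) := by
      intro x hx
      obtain ⟨i, hi, hxi⟩ := Finset.mem_biUnion.mp hx
      have hxi := (Finset.mem_filter.mp hxi).2
      exact Finset.mem_filter.mpr
        ⟨Finset.mem_univ x, (Finset.mem_filter.mp hi).2 _ hxi.1 hxi.2⟩
    rw [← Finset.card_filter]
    calc k * m ≤ W.card * m := by gcongr
      _ = ∑ i ∈ W, m := by simp
      _ ≤ ∑ i ∈ W, ((block i).card : ℝ) := Finset.sum_le_sum fun i hi => hblock i (hmem hi)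
      _ = ((W.biUnion block).card : ℝ) := by
        rw [Finset.card_biUnion hdisj]
        push_cast
        rfl
      _ ≤ _ := by exact_mod_cast Finset.card_le_card hsub
  have htotal : k * m ≤ ({x : Pt n | BB x ≠ g x}.ncard : ℝ) := by
    have hsum := factorial_mul_sum fun x : Pt n => if BB x ≠ g x then 1 else 0
    rw [← Finset.card_filter] at hsum
    rw [Set.ncard_eq_toFinset_card', Set.toFinset_ofPred]
    have hfac : (0 : ℝ) < n.factorial := by exact_mod_cast n.factorial_pos
    refine le_of_mul_le_mul_left ?_ hfac
    calc (n.factorial : ℝ) * (k * m) = ∑ _π : Equiv.Perm (Fin n), k * m := by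
          simp [Fintype.card_perm]
      _ ≤ _ := Finset.sum_le_sum fun π _ => hchain π
      _ = _ := by exact_mod_cast hsum.symm
  rw [hdist, le_div_iff₀ (by positivity)]
  refine le_trans ?_ htotal
  have : (1 - ε) * ((k : ℝ) - 1) / (3 * k) * 2 ^ n = (k - 1) * m := by
    rw [hm]
    ring
  rw [this]
  gcongr
  linarith
end

section
/- For every ε ∈ (0,1) there exists a constant C such that the following holds: for all integers m and ℓ ≥ 2 with C·ℓ ≤ √m and every balanced-blocks partition of {0,1}^m into ℓ blocks with associated balanced-blocks function BB, there exists a family of at least (1 − ε)·2^m/ℓ pairwise vertex-disjoint (ℓ−1)-tuples y₁ ≺ y₂ ≺ ⋯ ≺ y_{ℓ−1} of points of {0,1}^m such that BB(y₁) = true and BB(y_i) ≠ BB(y_{i+1}) for all 1 ≤ i < ℓ−1 (each tuple is a violation of (ℓ−2)-monotonicity, and distinct tuples use disjoint sets of points). -/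
/-- Every doubly stochastic matrix has a permutation supported on its nonzero entries. -/
theorem exists_perm_forall_ne_zero {ι : Type*} [Fintype ι] [DecidableEq ι] {M : Matrix ι ι ℝ}
    (hM : M ∈ doublyStochastic ℝ ι) : ∃ σ : Equiv.Perm ι, ∀ i, M i (σ i) ≠ 0 := by
  obtain ⟨w, hw0, hw1, hw⟩ := exists_eq_sum_perm_of_mem_doublyStochastic hM
  obtain ⟨σ, -, hσ⟩ : ∃ σ ∈ Finset.univ, w σ ≠ 0 :=
    Finset.exists_ne_zero_of_sum_ne_zero (by rw [hw1]; exact one_ne_zero)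
  refine ⟨σ, fun i => ne_of_gt ?_⟩
  have hσ' : 0 < w σ := lt_of_le_of_ne (hw0 σ) hσ.symm
  rw [← hw, Matrix.sum_apply]
  refine Finset.sum_pos' (fun τ _ => ?_) ⟨σ, Finset.mem_univ _, ?_⟩
  · rw [Matrix.smul_apply, smul_eq_mul]
    refine mul_nonneg (hw0 τ) ?_
    rw [Equiv.Perm.permMatrix, PEquiv.toMatrix_apply]
    split_ifs <;> norm_num
  · simpa [Equiv.Perm.permMatrix, PEquiv.toMatrix_apply] using hσ'

/-- A layered fractional flow `K` (every `K u v ≠ 0` goes from a layer to the next one) whose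
marginals on the first `n + 1` layers are uniform probability distributions yields as many
pairwise disjoint paths through these layers as the smallest of them has elements. -/
theorem exists_disjoint_paths {V : Type*} [Fintype V] [DecidableEq V] (layer : V → ℕ)
    (n N : ℕ) (s : ℕ → ℕ) (hs : ∀ i ≤ n, (Finset.univ.filter (fun v => layer v = i)).card = s i)
    (hN : ∀ i ≤ n, N ≤ s i) (K : V → V → ℝ) (hK0 : ∀ u v, 0 ≤ K u v)
    (hK : ∀ u v, K u v ≠ 0 → layer v = layer u + 1)
    (hrow : ∀ u, layer u < n → ∑ v, K u v = 1 / s (layer u))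
    (hcol : ∀ v, 0 < layer v → layer v ≤ n → ∑ u, K u v = 1 / s (layer v)) :
    ∃ T : Fin N → ℕ → V,
      (∀ a, ∀ i ≤ n, layer (T a i) = i) ∧
      (∀ a, ∀ i < n, K (T a i) (T a (i + 1)) ≠ 0) ∧
      ∀ a a', ∀ i ≤ n, T a i = T a' i → a = a' := by
  classical
  rcases Nat.eq_zero_or_pos N with rfl | hNpos
  · exact ⟨fun a => a.elim0, fun a => a.elim0, fun a => a.elim0, fun a => a.elim0⟩
  have hspos : ∀ i ≤ n, (0 : ℝ) < s i := fun i hi => by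
    exact_mod_cast hNpos.trans_le (hN i hi)
  have hsum : ∀ i ≤ n, ∑ v, (if layer v = i then (1 : ℝ) / s i else 0) = 1 := fun i hi => by
    rw [← Finset.sum_filter, Finset.sum_const, hs i hi, nsmul_eq_mul,
      mul_one_div_cancel (hspos i hi).ne']
  let load : V → ℝ := fun v => if layer v ≤ n then N / s (layer v) else 0
  have hload : ∀ v, load v ≤ 1 := fun v => by
    simp only [load]
    split_ifs with h
    · rw [div_le_one (hspos _ h)]
      exact_mod_cast hN _ h
    · exact zero_le_one
  let M : Matrix (V ⊕ Fin N) (V ⊕ Fin N) ℝ := fun x y =>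
    match x, y with
    | .inl u, .inl v => (if u = v then 1 - load u else 0) + (if layer u < n then N * K u v else 0)
    | .inl u, .inr _ => if layer u = n then 1 / s n else 0
    | .inr _, .inl v => if layer v = 0 then 1 / s 0 else 0
    | .inr _, .inr _ => 0
  have hM : M ∈ doublyStochastic ℝ (V ⊕ Fin N) := by
    rw [mem_doublyStochastic_iff_sum]
    refine ⟨?_, ?_, ?_⟩
    · rintro (u | a) (v | b) <;> simp only [M]
      · refine add_nonneg ?_ ?_
        · split_ifs
          · linarith [hload u]
          · exact le_rfl
        · split_ifs
          · exact mul_nonneg (Nat.cast_nonneg _) (hK0 u v)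
          · exact le_rfl
      · split_ifs <;> positivity
      · split_ifs <;> positivity
      · exact le_rfl
    · rintro (u | a)
      · simp only [M, Fintype.sum_sum_type, Finset.sum_add_distrib, Finset.sum_ite_eq,
          Finset.mem_univ, if_true, Finset.sum_const, Finset.card_univ, Fintype.card_fin,
          nsmul_eq_mul, load]
        rcases lt_trichotomy (layer u) n with h | h | h
        · simp only [h, h.le, h.ne, if_true, if_false, ← Finset.mul_sum, hrow u h]
          ring
        · simp [h]
          ring
        · simp [h.not_ge, h.not_gt, h.ne']
      · simp only [M, Fintype.sum_sum_type, Finset.sum_const_zero, add_zero]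
        exact hsum 0 (Nat.zero_le n)
    · rintro (v | a)
      · have hcolN : ∑ u, (if layer u < n then N * K u v else 0) =
            if 0 < layer v ∧ layer v ≤ n then (N : ℝ) / s (layer v) else 0 := by
          split_ifs with h
          · rw [div_eq_mul_one_div, ← hcol v h.1 h.2, Finset.mul_sum]
            refine Finset.sum_congr rfl fun u _ => ?_
            split_ifs with hu
            · rfl
            · by_cases h0 : K u v = 0
              · rw [h0, mul_zero]
              · have := hK u v h0
                omega
          · refine Finset.sum_eq_zero fun u _ => ?_
            split_ifs with hu
            · by_cases h0 : K u v = 0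
              · rw [h0, mul_zero]
              · have := hK u v h0
                omega
            · rfl
        simp only [M, Fintype.sum_sum_type, Finset.sum_add_distrib, Finset.sum_ite_eq',
          Finset.mem_univ, if_true, Finset.sum_const, Finset.card_univ, Fintype.card_fin,
          nsmul_eq_mul, hcolN, load]
        rcases Nat.eq_zero_or_pos (layer v) with h | h
        · simp [h]
          ring
        · by_cases h' : layer v ≤ n
          · simp [h, h', h.ne']
          · simp [h', h.ne']
      · simp only [M, Fintype.sum_sum_type, Finset.sum_const_zero, add_zero]
        exact hsum n le_rfl
  obtain ⟨σ, hσ⟩ := exists_perm_forall_ne_zero hM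
  have hstart : ∀ a, ∃ v, σ (.inr a) = .inl v ∧ layer v = 0 := fun a => by
    have h := hσ (.inr a)
    rcases hv : σ (.inr a) with v | c
    · rw [hv] at h
      refine ⟨v, rfl, ?_⟩
      by_contra h0
      exact h (if_neg h0)
    · rw [hv] at h
      exact absurd rfl h
  have hstep : ∀ u, layer u < n → σ (.inl u) ≠ .inl u →
      ∃ v, σ (.inl u) = .inl v ∧ K u v ≠ 0 := fun u hu hne => by
    have h := hσ (.inl u)
    rcases hv : σ (.inl u) with v | c
    · rw [hv] at h hne
      refine ⟨v, rfl, fun h0 => h ?_⟩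
      have huv : u ≠ v := fun e => hne (by rw [e])
      simp [M, huv, h0]
    · rw [hv] at h
      exact absurd (if_neg hu.ne) h
  have key : ∀ a, ∀ i ≤ n, ∃ v, (σ ^ (i + 1)) (.inr a) = .inl v ∧ layer v = i ∧
      (σ ^ i) (.inr a) ≠ .inl v := fun a i => by
    induction i with
    | zero =>
      intro _
      obtain ⟨v, hv, hv0⟩ := hstart a
      exact ⟨v, by simpa using hv, hv0, by simp⟩
    | succ i ih =>
      intro hi
      obtain ⟨u, hu, hui, hne⟩ := ih (by omega)
      have hfix : σ (.inl u) ≠ .inl u := fun h => hne <| σ.injective <| by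
        rw [h, ← hu, pow_succ', Equiv.Perm.mul_apply]
      obtain ⟨v, hv, hKv⟩ := hstep u (by omega) hfix
      have hlv := hK u v hKv
      refine ⟨v, by rw [pow_succ', Equiv.Perm.mul_apply, hu, hv], by omega, ?_⟩
      rw [hu]
      intro h
      rw [Sum.inl.inj h] at hlv
      omega
  have hV : Nonempty V := by
    obtain ⟨v, -⟩ := hstart ⟨0, hNpos⟩
    exact ⟨v⟩
  have key' : ∀ a i, ∃ v, i ≤ n → (σ ^ (i + 1)) (.inr a) = .inl v ∧ layer v = i ∧
      (σ ^ i) (.inr a) ≠ .inl v := fun a i => by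
    by_cases hi : i ≤ n
    · obtain ⟨v, hv⟩ := key a i hi
      exact ⟨v, fun _ => hv⟩
    · exact ⟨hV.some, fun h => absurd h hi⟩
  choose T hT using key'
  refine ⟨T, fun a i hi => (hT a i hi).2.1, fun a i hi => ?_, fun a a' i hi h => ?_⟩
  · obtain ⟨h1, h2, -⟩ := hT a i hi.le
    obtain ⟨h3, h4, h5⟩ := hT a (i + 1) hi
    have h6 : σ (.inl (T a i)) = .inl (T a (i + 1)) := by
      rw [← h1, ← h3, pow_succ' σ (i + 1), Equiv.Perm.mul_apply]
    rw [h1] at h5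
    obtain ⟨v, hv, hKv⟩ := hstep (T a i) (by omega) (by rw [h6]; exact h5.symm)
    rw [h6] at hv
    rwa [Sum.inl.inj hv]
  · have h1 := (hT a i hi).1
    rw [h, ← (hT a' i hi).1] at h1
    exact Sum.inr.inj ((σ ^ (i + 1)).injective h1)

/-- Choosing a level with probability proportional to `h` and then a uniform subset of `t` at that
level: a double counting identity. -/
theorem sum_subset_choose_div {α : Type*} [Fintype α] [DecidableEq α] (t : Finset α) (h : ℕ → ℝ)
    (hh : ∀ k ≤ Fintype.card α, t.card < k → h k = 0) :
    ∑ u, (if u ⊆ t then h u.card * (Fintype.card α).choose u.card / t.card.choose u.card else 0) =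
      ∑ u : Finset α, h u.card := by
  have h1 : (Finset.univ.filter (fun u => u ⊆ t)) = t.powerset := by ext; simp
  have h2 := Finset.sum_powerset_apply_card h (x := (Finset.univ : Finset α))
  rw [Finset.powerset_univ] at h2
  rw [← Finset.sum_filter, h1, h2, Finset.sum_powerset_apply_card
    (fun k => h k * (Fintype.card α).choose k / t.card.choose k), Finset.card_univ]
  have hsub : Finset.range (t.card + 1) ⊆ Finset.range (Fintype.card α + 1) := by
    rw [Finset.range_subset_range]
    exact Nat.succ_le_succ (Finset.card_le_univ t)
  rw [← Finset.sum_subset (f := fun k => (Fintype.card α).choose k • h k) hsub]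
  · refine Finset.sum_congr rfl fun k hk => ?_
    have hpos : (0 : ℝ) < t.card.choose k := by
      exact_mod_cast Nat.choose_pos (Nat.lt_succ_iff.1 (Finset.mem_range.1 hk))
    simp only [nsmul_eq_mul]
    field_simp
  · intro k hk' hk
    rw [Finset.mem_range] at hk hk'
    rw [hh k (by omega) (by omega), smul_zero]

/-- The version of `sum_subset_choose_div` for supersets. -/
theorem sum_superset_choose_div {α : Type*} [Fintype α] [DecidableEq α] (t : Finset α) (h : ℕ → ℝ)
    (hh : ∀ k, k < t.card → h k = 0) :
    ∑ v, (if t ⊆ v then h v.card * (Fintype.card α).choose v.card /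
        (Fintype.card α - t.card).choose (v.card - t.card) else 0) =
      ∑ v : Finset α, h v.card := by
  have h1 := sum_subset_choose_div tᶜ (fun k => h (Fintype.card α - k)) (fun k hk' hk => by
    rw [Finset.card_compl] at hk
    exact hh _ (by omega))
  rw [← Equiv.sum_comp (compl_involutive (α := Finset α)).toPerm,
    ← Equiv.sum_comp (compl_involutive (α := Finset α)).toPerm (fun v => h v.card)]
  simp only [Function.Involutive.coe_toPerm, Finset.card_compl] at h1 ⊢
  rw [← h1]
  refine Finset.sum_congr rfl fun u _ => ?_
  by_cases hu : u ⊆ tᶜ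
  · have hu' : t ⊆ uᶜ := by rwa [Finset.subset_compl_comm]
    have hcard := Finset.card_le_card hu
    rw [Finset.card_compl] at hcard
    rw [if_pos hu, if_pos hu', Nat.choose_symm (Finset.card_le_univ u),
      show Fintype.card α - u.card - t.card = Fintype.card α - t.card - u.card by omega,
      Nat.choose_symm hcard]
  · have hu' : ¬ t ⊆ uᶜ := by rwa [Finset.subset_compl_comm]
    rw [if_neg hu, if_neg hu']

/-- If the levels of the Boolean lattice are grouped into consecutive blocks of which the first
`n + 1` have at least `N` elements each, then there are `N` pairwise disjoint chains with exactly
one element in each of these blocks. -/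
theorem exists_disjoint_block_chains {α : Type*} [Fintype α] [DecidableEq α] {β : ℕ → ℕ}
    (hβ : Monotone β) (n N : ℕ)
    (hN : ∀ i ≤ n, N ≤ (Finset.univ.filter (fun u : Finset α => β u.card = i)).card) :
    ∃ T : Fin N → ℕ → Finset α,
      (∀ a, ∀ i ≤ n, β (T a i).card = i) ∧
      (∀ a, ∀ i < n, T a i ⊆ T a (i + 1)) ∧
      ∀ a a', ∀ i ≤ n, T a i = T a' i → a = a' := by
  rcases Nat.eq_zero_or_pos N with rfl | hNpos
  · exact ⟨fun a => a.elim0, fun a => a.elim0, fun a => a.elim0, fun a => a.elim0⟩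
  obtain ⟨s, hs⟩ : ∃ s : ℕ → ℕ, ∀ i,
      (Finset.univ.filter (fun u : Finset α => β u.card = i)).card = s i := ⟨_, fun _ => rfl⟩
  simp only [hs] at hN
  have hspos : ∀ i ≤ n, (s i : ℝ) ≠ 0 := fun i hi =>
    Nat.cast_ne_zero.2 (hNpos.trans_le (hN i hi)).ne'
  let K : Finset α → Finset α → ℝ := fun u v =>
    if u ⊆ v ∧ β v.card = β u.card + 1 then
      1 / (s (β u.card) * s (β v.card)) * (Fintype.card α).choose u.card / v.card.choose u.card
    else 0
  have hsum : ∀ i, ∀ c : ℝ, ∑ u : Finset α, (if β u.card = i then c else 0) = s i * c := fun i c => by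
    rw [← Finset.sum_filter, Finset.sum_const, nsmul_eq_mul, hs]
  have hKne : ∀ u v, K u v ≠ 0 → u ⊆ v ∧ β v.card = β u.card + 1 := fun u v h => by
    by_contra h0
    exact h (if_neg h0)
  have hrow : ∀ u : Finset α, β u.card < n → ∑ v, K u v = 1 / s (β u.card) := by
    intro u hu
    have h := sum_superset_choose_div u
      (fun k => if β k = β u.card + 1 then 1 / ((s (β u.card) : ℝ) * s (β u.card + 1)) else 0)
      (fun k hk => if_neg fun h => by
        have := hβ hk.le
        omega)
    rw [hsum] at h
    have hu1 := hspos (β u.card) (by omega)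
    have hu2 := hspos (β u.card + 1) (by omega)
    trans (s (β u.card + 1)) * (1 / ((s (β u.card) : ℝ) * s (β u.card + 1)))
    · rw [← h]
      refine Finset.sum_congr rfl fun v _ => ?_
      by_cases huv : u ⊆ v
      · by_cases hb : β v.card = β u.card + 1
        · have hle := Finset.card_le_card huv
          have hmul : ((Fintype.card α).choose v.card : ℝ) * v.card.choose u.card =
              (Fintype.card α).choose u.card *
                (Fintype.card α - u.card).choose (v.card - u.card) := by
            exact_mod_cast Nat.choose_mul hle
          have hp1 : (v.card.choose u.card : ℝ) ≠ 0 :=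
            Nat.cast_ne_zero.2 (Nat.choose_pos hle).ne'
          have hp2 : ((Fintype.card α - u.card).choose (v.card - u.card) : ℝ) ≠ 0 :=
            Nat.cast_ne_zero.2 (Nat.choose_pos
              (Nat.sub_le_sub_right (Finset.card_le_univ v) _)).ne'
          simp only [K, huv, hb, and_self, if_true]
          rw [div_eq_div_iff hp1 hp2, mul_assoc, mul_assoc, hmul]
        · simp [K, huv, hb]
      · simp [K, huv]
    · field_simp
  have hcol : ∀ v : Finset α, 0 < β v.card → β v.card ≤ n → ∑ u, K u v = 1 / s (β v.card) := by
    intro v hv0 hvn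
    obtain ⟨i, hi⟩ : ∃ i, β v.card = i + 1 := ⟨β v.card - 1, by omega⟩
    have h := sum_subset_choose_div v
      (fun k => if β k = i then 1 / ((s i : ℝ) * s (i + 1)) else 0)
      (fun k _ hk => if_neg fun h => by
        have := hβ hk.le
        omega)
    rw [hsum] at h
    have hu1 := hspos i (by omega)
    have hu2 := hspos (i + 1) (by omega)
    trans (s i : ℝ) * (1 / ((s i : ℝ) * s (i + 1)))
    · rw [← h]
      refine Finset.sum_congr rfl fun u _ => ?_
      by_cases huv : u ⊆ v
      · by_cases hb : β u.card = i
        · simp [K, huv, hb, hi]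
        · simp [K, huv, hb, hi, Ne.symm hb]
      · simp [K, huv]
    · rw [hi]
      field_simp
  obtain ⟨T, h1, h2, h3⟩ := exists_disjoint_paths (fun u : Finset α => β u.card) n N s
    (fun i _ => hs i) hN K (fun u v => by simp only [K]; split_ifs <;> positivity)
    (fun u v h => (hKne u v h).2) hrow hcol
  exact ⟨T, h1, fun a i hi => (hKne _ _ (h2 a i hi)).1, h3⟩

/-- The number of blocks lying entirely below the level `w`. -/
def blockIndex (ℓ : ℕ) (b : ℕ → ℕ) (w : ℕ) : ℕ :=
  ((Finset.range ℓ).filter (fun i => b (i + 1) ≤ w)).card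

theorem blockIndex_monotone (ℓ : ℕ) (b : ℕ → ℕ) : Monotone (blockIndex ℓ b) := fun _ _ h =>
  Finset.card_le_card (Finset.monotone_filter_right _ fun _ _ hi => le_trans hi h)

theorem blockIndex_eq {ℓ : ℕ} {b : ℕ → ℕ} (hb : ∀ i < ℓ, b i < b (i + 1)) {i w : ℕ} (hi : i < ℓ)
    (h1 : b i ≤ w) (h2 : w < b (i + 1)) : blockIndex ℓ b w = i := by
  have hmono : ∀ j k, j ≤ k → k ≤ ℓ → b j ≤ b k := fun j k hjk => by
    induction k, hjk using Nat.le_induction with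
    | base => exact fun _ => le_rfl
    | succ k _ ih => exact fun hk => (ih (by omega)).trans (hb k (by omega)).le
  have : (Finset.range ℓ).filter (fun i => b (i + 1) ≤ w) = Finset.range i := by
    ext j
    rw [Finset.mem_filter, Finset.mem_range, Finset.mem_range]
    constructor
    · rintro ⟨hj, hjw⟩
      by_contra hij
      have := hmono (i + 1) (j + 1) (by omega) (by omega)
      omega
    · intro hj
      exact ⟨by omega, (hmono (j + 1) i hj hi.le).trans h1⟩
  rw [blockIndex, this, Finset.card_range]

theorem exists_block {ℓ : ℕ} {b : ℕ → ℕ} (h0 : b 0 = 0) {w : ℕ} (hw : w < b ℓ) :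
    ∃ i < ℓ, b i ≤ w ∧ w < b (i + 1) := by
  induction ℓ with
  | zero => omega
  | succ ℓ ih =>
    rcases lt_or_ge w (b ℓ) with h | h
    · obtain ⟨i, hi, hiw⟩ := ih h
      exact ⟨i, by omega, hiw⟩
    · exact ⟨ℓ, by omega, h, hw⟩

/-- The correspondence between points of the hypercube and subsets of the coordinates. -/
def ptEquivFinset (m : ℕ) : Pt m ≃ Finset (Fin m) where
  toFun x := Finset.univ.filter (fun i => x i = true)
  invFun s i := decide (i ∈ s)
  left_inv x := by ext i; simp
  right_inv s := by ext i; simp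

theorem wt_ptEquivFinset_symm {m : ℕ} (s : Finset (Fin m)) :
    wt ((ptEquivFinset m).symm s) = s.card := by
  simp [wt, ptEquivFinset]

theorem ple_ptEquivFinset_symm {m : ℕ} {s t : Finset (Fin m)} (h : s ⊆ t) :
    ple ((ptEquivFinset m).symm s) ((ptEquivFinset m).symm t) := by
  intro i
  by_cases hi : i ∈ s
  · simp [ptEquivFinset, hi, h hi]
  · simp [ptEquivFinset, hi]

/-- For every `ε ∈ (0,1)` there is a constant `C` such that for all `m` and
`ℓ ≥ 2` with `C·ℓ ≤ √m` and every balanced-blocks partition of `{0,1}^m` into `ℓ` blocks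
with associated function `BB`, there is a family of at least `(1 − ε)·2^m/ℓ` pairwise
vertex-disjoint `(ℓ−1)`-tuples `y₁ ≺ ⋯ ≺ y_{ℓ−1}` (indexed `T a 0, …, T a (ℓ-2)`) with
`BB y₁ = true` and `BB` alternating along each tuple. -/
theorem stmt6 (ε : ℝ) (hε0 : 0 < ε) (hε1 : ε < 1) :
    ∃ C : ℝ, ∀ (m ℓ : ℕ), 2 ≤ ℓ → (C * (ℓ : ℝ) ≤ Real.sqrt m) →
      ∀ (b : ℕ → ℕ) (BB : Pt m → Bool),
        IsBBPartition m ℓ b → IsBBFun m ℓ b BB →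
        ∃ (M : ℕ) (T : Fin M → ℕ → Pt m),
          (1 - ε) * 2 ^ m / (ℓ : ℝ) ≤ (M : ℝ) ∧
          (∀ a : Fin M,
            (∀ i, i + 1 < ℓ - 1 → plt (T a i) (T a (i + 1))) ∧
            BB (T a 0) = true ∧
            (∀ i, i + 1 < ℓ - 1 → BB (T a i) ≠ BB (T a (i + 1)))) ∧
          (∀ a a' : Fin M, a ≠ a' →
            ∀ i j, i < ℓ - 1 → j < ℓ - 1 → T a i ≠ T a' j) := by
  refine ⟨1 / ε, fun m ℓ hℓ hC b BB hb hBB => ?_⟩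
  obtain ⟨hb0, hbℓ, hbs, hcard⟩ := hb
  have hℓpos : (0 : ℝ) < ℓ := by exact_mod_cast (by omega : 0 < ℓ)
  have hC' : (ℓ : ℝ) ≤ ε * Real.sqrt m := by
    rwa [one_div, inv_mul_le_iff₀ hε0] at hC
  have hsqrt : 0 < Real.sqrt m := pos_of_mul_pos_right (hℓpos.trans_le hC') hε0.le
  have hratio : (ℓ : ℝ) / Real.sqrt m ≤ ε := (div_le_iff₀ hsqrt).2 hC'
  have hblock : ∀ w ≤ m, ∀ i < ℓ, blockIndex ℓ b w = i ↔ b i ≤ w ∧ w < b (i + 1) := by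
    intro w hw i hi
    refine ⟨fun h => ?_, fun h => blockIndex_eq hbs hi h.1 h.2⟩
    obtain ⟨j, hj, hj1, hj2⟩ := exists_block hb0 (w := w) (ℓ := ℓ) (by omega)
    rw [blockIndex_eq hbs hj hj1 hj2] at h
    exact h ▸ ⟨hj1, hj2⟩
  have hwt : ∀ y : Pt m, wt y ≤ m := fun y =>
    (Finset.card_le_univ _).trans_eq (Fintype.card_fin m)
  have hBBi : ∀ y : Pt m, ∀ i < ℓ, blockIndex ℓ b (wt y) = i → (BB y = true ↔ Even i) := by
    intro y i hi hy
    rw [hBB y]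
    constructor
    · rintro ⟨j, hj, hje, hjy⟩
      rwa [← hy, (hblock _ (hwt y) j hj).2 hjy]
    · exact fun he => ⟨i, hi, he, (hblock _ (hwt y) i hi).1 hy⟩
  have hN : ∀ i ≤ ℓ - 2, ⌈(1 - ε) * 2 ^ m / (ℓ : ℝ)⌉₊ ≤ (Finset.univ.filter
      (fun u : Finset (Fin m) => blockIndex ℓ b u.card = i)).card := by
    intro i hi
    have hiℓ : i < ℓ := by omega
    rw [Nat.ceil_le]
    have heq : {y : Pt m | b i ≤ wt y ∧ wt y < b (i + 1)}.ncard = (Finset.univ.filter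
        (fun u : Finset (Fin m) => blockIndex ℓ b u.card = i)).card := by
      rw [← Set.ncard_coe_finset, ← Set.ncard_image_of_injective _ (ptEquivFinset m).symm.injective]
      congr 1
      ext y
      obtain ⟨u, rfl⟩ := (ptEquivFinset m).symm.surjective y
      have hu := hblock _ (hwt ((ptEquivFinset m).symm u)) i hiℓ
      rw [wt_ptEquivFinset_symm] at hu
      simp [wt_ptEquivFinset_symm, hu]
    rw [← heq]
    refine le_trans ?_ (hcard i hiℓ).1
    gcongr
  obtain ⟨T, hT1, hT2, hT3⟩ := exists_disjoint_block_chains (blockIndex_monotone ℓ b) (ℓ - 2) _ hN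
  have hlayer : ∀ a, ∀ i < ℓ - 1, blockIndex ℓ b (wt ((ptEquivFinset m).symm (T a i))) = i :=
    fun a i hi => by rw [wt_ptEquivFinset_symm, hT1 a i (by omega)]
  refine ⟨_, fun a i => (ptEquivFinset m).symm (T a i), Nat.le_ceil _,
    fun a => ⟨fun i hi => ⟨ple_ptEquivFinset_symm (hT2 a i (by omega)), fun h => ?_⟩, ?_,
      fun i hi h => ?_⟩, fun a a' ha i j hi hj h => ha ?_⟩
  · dsimp only at h
    have h1 := hlayer a i (by omega)
    rw [h, hlayer a (i + 1) hi] at h1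
    omega
  · exact (hBBi _ 0 (by omega) (hlayer a 0 (by omega))).2 Even.zero
  · have h1 := hBBi _ i (by omega) (hlayer a i (by omega))
    have h2 := hBBi _ (i + 1) (by omega) (hlayer a (i + 1) hi)
    rw [h, h2, Nat.even_add_one] at h1
    tauto
  · dsimp only at h
    have hij : i = j := by
      rw [← hlayer a i hi, h, hlayer a' j hj]
    subst hij
    exact hT3 a a' i (by omega) ((ptEquivFinset m).symm.injective h)
end

section
/- For all integers m ≥ 1 and ℓ ≥ 2 and every balanced-blocks partition of {0,1}^m into ℓ blocks, the associated balanced-blocks function BB is not (ℓ−2)-monotone; that is, there exist points y₁ ≺ y₂ ≺ ⋯ ≺ y_{ℓ−1} with BB(y₁) = true and BB(y_i) ≠ BB(y_{i+1}) for all 1 ≤ i < ℓ−1. -/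
/-- The point whose first `k` coordinates are `true` has weight `k`. -/
theorem wt_initial {m k : ℕ} (hk : k ≤ m) :
    wt (fun j : Fin m => decide ((j : ℕ) < k)) = k := by
  simp [wt, Fin.card_filter_val_lt, hk]

/-- The endpoints of a partition into nonempty consecutive intervals are strictly increasing. -/
theorem lt_of_forall_lt_succ {ℓ : ℕ} {b : ℕ → ℕ} (h : ∀ i < ℓ, b i < b (i + 1)) {i j : ℕ}
    (hij : i < j) (hj : j ≤ ℓ) : b i < b j := by
  induction j, hij using Nat.le_induction with
  | base => exact h i hj
  | succ j _ ih => exact (ih (by omega)).trans (h j hj)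

/-- For all `m ≥ 1` and `ℓ ≥ 2`, the balanced-blocks function associated to
any balanced-blocks partition of `{0,1}^m` into `ℓ` blocks is not `(ℓ−2)`-monotone: there
are points `y₁ ≺ ⋯ ≺ y_{ℓ−1}` with `BB y₁ = true` and `BB` alternating along the chain. -/
theorem stmt8 (m ℓ : ℕ) (hm : 1 ≤ m) (hℓ : 2 ≤ ℓ) (b : ℕ → ℕ) (BB : Pt m → Bool)
    (hb : IsBBPartition m ℓ b) (hBB : IsBBFun m ℓ b BB) :
    ∃ y : ℕ → Pt m, (∀ i, i + 1 < ℓ - 1 → plt (y i) (y (i + 1))) ∧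
      BB (y 0) = true ∧ ∀ i, i + 1 < ℓ - 1 → BB (y i) ≠ BB (y (i + 1)) := by
  obtain ⟨-, hbℓ, hlt, -⟩ := hb
  have hwt : ∀ i < ℓ, wt (fun j : Fin m => decide ((j : ℕ) < b i)) = b i := fun i hi =>
    wt_initial (by have := lt_of_forall_lt_succ hlt hi le_rfl; omega)
  have hval : ∀ i < ℓ, (BB (fun j : Fin m => decide ((j : ℕ) < b i)) = true ↔ Even i) := by
    intro i hi
    rw [hBB, hwt i hi]
    constructor
    · rintro ⟨k, hk, hke, h₁, h₂⟩
      obtain rfl : k = i := by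
        rcases lt_trichotomy k i with h | h | h
        · rcases (show k + 1 ≤ i from h).eq_or_lt with rfl | h'
          · omega
          · have := lt_of_forall_lt_succ hlt h' hi.le
            omega
        · exact h
        · have := lt_of_forall_lt_succ hlt h hk.le
          omega
      exact hke
    · exact fun he => ⟨i, hi, he, le_rfl, hlt i hi⟩
  refine ⟨fun i j => decide ((j : ℕ) < b i), fun i hi => ⟨fun j => ?_, fun h => ?_⟩,
    (hval 0 (by omega)).2 Even.zero, fun i hi h => ?_⟩
  · have := hlt i (by omega)
    rw [Bool.le_iff_imp]
    simp only [decide_eq_true_eq]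
    omega
  · have h' := congrArg wt h
    rw [hwt i (by omega), hwt (i + 1) (by omega)] at h'
    exact (hlt i (by omega)).ne h'
  · have h₁ := hval i (by omega)
    have h₂ := hval (i + 1) (by omega)
    rw [h, h₂, Nat.even_add_one] at h₁
    tauto
end

section
/- Let f, g : (Fin n → Bool) → Bool, let k < m be nonnegative integers, and suppose g is k-monotone. If x₁ ≺ x₂ ≺ ⋯ ≺ x_{m+1} is a chain of points with f(x₁) = true and f(x_i) ≠ f(x_{i+1}) for all 1 ≤ i ≤ m, then the number of indices i ∈ {1,…,m+1} with f(x_i) ≠ g(x_i) is at least (m − k)/2. -/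
theorem plt_of_chain {n m : ℕ} {x : ℕ → Pt n} (hchain : ∀ i < m, plt (x i) (x (i + 1)))
    {a b : ℕ} (hab : a < b) (hb : b ≤ m) : plt (x a) (x b) := by
  have hlt : x a < x b := by
    induction b, hab using Nat.le_induction with
    | base => exact lt_iff_le_and_ne.2 (hchain a (by omega))
    | succ b _ ih => exact (ih (by omega)).trans (lt_iff_le_and_ne.2 (hchain b (by omega)))
  exact lt_iff_le_and_ne.1 hlt

theorem eq_decide_even_of_alternating {m : ℕ} {u : ℕ → Bool} (h0 : u 0 = true)
    (halt : ∀ i < m, u i ≠ u (i + 1)) : ∀ i ≤ m, u i = decide (Even i) := by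
  intro i
  induction i with
  | zero => simpa using h0
  | succ i ih =>
    intro hi
    have h1 := halt i (by omega)
    rw [ih (by omega)] at h1
    by_cases he : Even i <;> simp_all [Nat.even_add_one]

/-- Any Boolean sequence `v` of length `i` has an alternating subsequence starting with `true`
whose length `c` falls short of `i` by at most twice the number of positions where `v` differs
from the sequence `true, false, true, …`. -/
theorem exists_alternating_subsequence (v : ℕ → Bool) (i : ℕ) :
    ∃ (c : ℕ) (t : ℕ → ℕ), (∀ j < c, t j < i) ∧ (∀ j, j + 1 < c → t j < t (j + 1)) ∧
      (∀ j < c, v (t j) = decide (Even j)) ∧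
      i ≤ c + 2 * ((Finset.range i).filter (fun j => decide (Even j) ≠ v j)).card := by
  induction i with
  | zero => exact ⟨0, id, by simp⟩
  | succ i ih =>
    obtain ⟨c, t, hlt, hmono, hval, hcard⟩ := ih
    rw [Finset.range_add_one, Finset.filter_insert]
    by_cases hv : v i = decide (Even c)
    · refine ⟨c + 1, Function.update t c i, fun j hj => ?_, fun j hj => ?_, fun j hj => ?_, ?_⟩
      · rcases eq_or_ne j c with rfl | hjc
        · simp
        · rw [Function.update_of_ne hjc]
          exact (hlt j (by omega)).trans (Nat.lt_succ_self i)
      · rw [Function.update_of_ne (by omega : j ≠ c)]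
        rcases eq_or_ne (j + 1) c with rfl | hjc
        · simpa using hlt j (by omega)
        · rw [Function.update_of_ne hjc]
          exact hmono j (by omega)
      · rcases eq_or_ne j c with rfl | hjc
        · simpa using hv
        · rw [Function.update_of_ne hjc]
          exact hval j (by omega)
      · split_ifs
        · rw [Finset.card_insert_of_notMem (by simp)]
          omega
        · omega
    · refine ⟨c, t, fun j hj => (hlt j hj).trans (Nat.lt_succ_self i), hmono, hval, ?_⟩
      split_ifs with hd
      · rw [Finset.card_insert_of_notMem (by simp)]
        omega
      · have hpar : ¬(Even i ↔ Even c) := fun h => hv (by rw [← not_not.1 hd]; simp [h])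
        simp only [Nat.even_iff] at hpar
        omega

/-- If `g` is `k`-monotone, `k < m`, and `x 0 ≺ x 1 ≺ ⋯ ≺ x m` is a chain
with `f (x 0) = true` and `f` alternating along it, then `f` and `g` disagree on at least
`(m − k)/2` of the points `x 0, …, x m`. -/
theorem stmt9 (n : ℕ) (f g : Pt n → Bool) (k m : ℕ) (hkm : k < m)
    (hg : IsKMono k g) (x : ℕ → Pt n)
    (hchain : ∀ i < m, plt (x i) (x (i + 1)))
    (hx0 : f (x 0) = true)
    (halt : ∀ i < m, f (x i) ≠ f (x (i + 1))) :
    ((m : ℝ) - k) / 2 ≤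
      (((Finset.range (m + 1)).filter (fun i => f (x i) ≠ g (x i))).card : ℝ) := by
  have hf := eq_decide_even_of_alternating (u := fun i => f (x i)) hx0 halt
  obtain ⟨c, t, hlt, hmono, hval, hcard⟩ :=
    exists_alternating_subsequence (fun i => g (x i)) (m + 1)
  have hck : c ≤ k := by
    by_contra! hkc
    refine hg ⟨fun j => x (t j), fun j hj => ?_, ?_, fun j hj => ?_⟩
    · exact plt_of_chain hchain (hmono j (by omega)) (Nat.lt_succ_iff.1 (hlt _ (by omega)))
    · simpa using hval 0 (by omega)
    · have h1 := hval j (by omega)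
      have h2 := hval (j + 1) (by omega)
      by_cases he : Even j <;> simp_all [Nat.even_add_one]
  have hfilter : (Finset.range (m + 1)).filter (fun i => f (x i) ≠ g (x i)) =
      (Finset.range (m + 1)).filter (fun i => decide (Even i) ≠ g (x i)) :=
    Finset.filter_congr fun i hi => by
      rw [← hf i (Nat.lt_succ_iff.1 (Finset.mem_range.1 hi))]
  rw [hfilter]
  have hreal := (Nat.cast_le (α := ℝ)).2 (hcard.trans (Nat.add_le_add_right hck _))
  push_cast at hreal
  linarith
end

section
/- For all integers m ≥ 1 and ℓ ≥ 1 with 2·ℓ ≤ √m, and every balanced-blocks partition of {0,1}^m into ℓ blocks with intervals I₁, …, I_ℓ, every interval satisfies |I_i| ≥ √m/(8·ℓ). -/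
theorem centralBinom_sq_mul_le (n : ℕ) : n.centralBinom ^ 2 * (2 * n + 1) ≤ 16 ^ n := by
  induction n with
  | zero => simp
  | succ n ih =>
    have h := Nat.succ_mul_centralBinom_succ n
    have hpos : 0 < (n + 1) ^ 2 := by positivity
    refine Nat.le_of_mul_le_mul_left ?_ hpos
    calc (n + 1) ^ 2 * ((n + 1).centralBinom ^ 2 * (2 * (n + 1) + 1))
        = ((n + 1) * (n + 1).centralBinom) ^ 2 * (2 * n + 3) := by ring
      _ = 4 * (2 * n + 1) * (2 * n + 3) * (n.centralBinom ^ 2 * (2 * n + 1)) := by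
          rw [h]; ring
      _ ≤ 4 * (2 * n + 1) * (2 * n + 3) * 16 ^ n := by gcongr
      _ ≤ (16 * (n + 1) ^ 2) * 16 ^ n := Nat.mul_le_mul_right _ (by nlinarith)
      _ = (n + 1) ^ 2 * 16 ^ (n + 1) := by ring

theorem choose_sq_mul_le_four_pow (m k : ℕ) : m.choose k ^ 2 * m ≤ 4 ^ m := by
  obtain ⟨n, rfl | rfl⟩ := m.even_or_odd'
  · calc (2 * n).choose k ^ 2 * (2 * n) ≤ n.centralBinom ^ 2 * (2 * n + 1) := by
          gcongr
          · exact Nat.choose_le_centralBinom k n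
          · omega
      _ ≤ 16 ^ n := centralBinom_sq_mul_le n
      _ = 4 ^ (2 * n) := by rw [pow_mul]; norm_num
  · have h : (2 * n + 1).choose k ≤ 2 * n.centralBinom := by
      cases k with
      | zero =>
        have := n.centralBinom_pos
        rw [Nat.choose_zero_right]
        omega
      | succ k =>
        rw [Nat.choose_succ_succ']
        have h₁ := Nat.choose_le_centralBinom k n
        have h₂ := Nat.choose_le_centralBinom (k + 1) n
        omega
    calc (2 * n + 1).choose k ^ 2 * (2 * n + 1)
        ≤ (2 * n.centralBinom) ^ 2 * (2 * n + 1) := by gcongr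
      _ = 4 * (n.centralBinom ^ 2 * (2 * n + 1)) := by ring
      _ ≤ 4 * 16 ^ n := by gcongr; exact centralBinom_sq_mul_le n
      _ = 4 ^ (2 * n + 1) := by rw [pow_succ, pow_mul]; norm_num [mul_comm]

theorem choose_mul_sqrt_le_two_pow (m k : ℕ) : (m.choose k : ℝ) * √m ≤ 2 ^ m := by
  refine le_of_sq_le_sq ?_ (by positivity)
  rw [mul_pow, Real.sq_sqrt (by positivity), ← pow_mul, mul_comm m, pow_mul]
  norm_num only
  exact_mod_cast choose_sq_mul_le_four_pow m k

theorem card_wt_eq_le_choose (m k : ℕ) :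
    (Finset.univ.filter fun y : Pt m => wt y = k).card ≤ m.choose k := by
  calc (Finset.univ.filter fun y : Pt m => wt y = k).card
      ≤ (Finset.powersetCard k (Finset.univ : Finset (Fin m))).card := by
        refine Finset.card_le_card_of_injOn
          (fun y => Finset.univ.filter fun i => y i = true) ?_ ?_
        · intro y hy
          have h := (Finset.mem_filter.1 (Finset.mem_coe.1 hy)).2
          simpa [wt, Finset.mem_powersetCard] using h
        · intro x _ y _ hxy
          funext i
          have := Finset.ext_iff.1 hxy i
          simp only [Finset.mem_filter, Finset.mem_univ, true_and] at this
          exact Bool.eq_iff_iff.2 this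
    _ = m.choose k := by simp

theorem ncard_wt_mem_Ico_le (m a c : ℕ) :
    {y : Pt m | a ≤ wt y ∧ wt y < c}.ncard ≤ ∑ k ∈ Finset.Ico a c, m.choose k := by
  have h : {y : Pt m | a ≤ wt y ∧ wt y < c} =
      ((Finset.Ico a c).biUnion fun k => Finset.univ.filter fun y : Pt m => wt y = k :
        Finset (Pt m)) := by
    ext y; simp
  rw [h, Set.ncard_coe_finset]
  exact Finset.card_biUnion_le.trans (Finset.sum_le_sum fun k _ => card_wt_eq_le_choose m k)

theorem ncard_wt_mem_Ico_mul_sqrt_le (m a c : ℕ) :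
    ({y : Pt m | a ≤ wt y ∧ wt y < c}.ncard : ℝ) * √m ≤ ((c - a : ℕ) : ℝ) * 2 ^ m := by
  calc ({y : Pt m | a ≤ wt y ∧ wt y < c}.ncard : ℝ) * √m
      ≤ (∑ k ∈ Finset.Ico a c, (m.choose k : ℝ)) * √m := by
        gcongr
        exact_mod_cast ncard_wt_mem_Ico_le m a c
    _ = ∑ k ∈ Finset.Ico a c, (m.choose k : ℝ) * √m := Finset.sum_mul ..
    _ ≤ ∑ _k ∈ Finset.Ico a c, (2 : ℝ) ^ m :=
        Finset.sum_le_sum fun k _ => choose_mul_sqrt_le_two_pow m k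
    _ = ((c - a : ℕ) : ℝ) * 2 ^ m := by simp

/-- For all `m ≥ 1` and `ℓ ≥ 1` with `2·ℓ ≤ √m`, every interval
`I_i = [b (i-1), b i)` of a balanced-blocks partition of `{0,1}^m` into `ℓ` blocks
has length at least `√m/(8·ℓ)`. -/
theorem stmt12 (m ℓ : ℕ) (hm : 1 ≤ m) (hℓ : 1 ≤ ℓ)
    (hℓm : (2 : ℝ) * ℓ ≤ Real.sqrt m) (b : ℕ → ℕ) (hb : IsBBPartition m ℓ b) :
    ∀ i < ℓ, Real.sqrt m / (8 * ℓ) ≤ ((b (i + 1) - b i : ℕ) : ℝ) := by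
  intro i hi
  have hlow := (hb.2.2.2 i hi).1
  have hup := ncard_wt_mem_Ico_mul_sqrt_le m (b i) (b (i + 1))
  have hℓ0 : (0 : ℝ) < ℓ := by exact_mod_cast hℓ
  have hs : 0 < √(m : ℝ) := by positivity
  have hhalf : (ℓ : ℝ) / √m ≤ 1 / 2 := by
    rw [div_le_iff₀ hs]; linarith
  have hblock : √(m : ℝ) / (2 * ℓ) * 2 ^ m ≤ ((b (i + 1) - b i : ℕ) : ℝ) * 2 ^ m :=
    calc √(m : ℝ) / (2 * ℓ) * 2 ^ m = (1 - 1 / 2) * 2 ^ m / ℓ * √m := by field_simp; norm_num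
      _ ≤ (1 - ℓ / √m) * 2 ^ m / ℓ * √m := by gcongr
      _ ≤ _ := (mul_le_mul_of_nonneg_right hlow hs.le).trans hup
  refine le_trans ?_ (le_of_mul_le_mul_right hblock (by positivity))
  gcongr
  norm_num
end

section
/- For every integer n ≥ 1, the central binomial coefficient satisfies (n choose ⌊n/2⌋) ≤ 2·2^n/√n, where the inequality is over the real numbers. -/
theorem two_mul_add_one_mul_centralBinom_sq_le (m : ℕ) :
    (2 * m + 1) * m.centralBinom ^ 2 ≤ 16 ^ m := by
  induction m with
  | zero => simp
  | succ m ih =>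
    have hpos : 0 < (m + 1) ^ 2 := by positivity
    refine Nat.le_of_mul_le_mul_left ?_ hpos
    calc (m + 1) ^ 2 * ((2 * (m + 1) + 1) * (m + 1).centralBinom ^ 2)
        = (2 * m + 3) * ((m + 1) * (m + 1).centralBinom) ^ 2 := by ring
      _ = 4 * (2 * m + 3) * (2 * m + 1) * ((2 * m + 1) * m.centralBinom ^ 2) := by
        rw [Nat.succ_mul_centralBinom_succ]; ring
      _ ≤ 4 * (2 * m + 3) * (2 * m + 1) * 16 ^ m := by gcongr
      _ ≤ 16 * (m + 1) ^ 2 * 16 ^ m := by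
        refine Nat.mul_le_mul_right _ ?_
        nlinarith
      _ = (m + 1) ^ 2 * 16 ^ (m + 1) := by ring

theorem two_mul_choose_eq_centralBinom_succ (m : ℕ) :
    2 * (2 * m + 1).choose m = (m + 1).centralBinom := by
  rw [Nat.centralBinom_eq_two_mul_choose, show 2 * (m + 1) = 2 * m + 1 + 1 by ring,
    Nat.choose_succ_succ, Nat.choose_symm_half, two_mul]

theorem mul_choose_half_sq_le (n : ℕ) : n * n.choose (n / 2) ^ 2 ≤ 4 ^ n := by
  obtain ⟨m, rfl | rfl⟩ := n.even_or_odd'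
  · have h := two_mul_add_one_mul_centralBinom_sq_le m
    rw [Nat.centralBinom_eq_two_mul_choose] at h
    rw [Nat.mul_div_cancel_left m two_pos, pow_mul]
    norm_num
    nlinarith
  · have h := two_mul_add_one_mul_centralBinom_sq_le (m + 1)
    rw [← two_mul_choose_eq_centralBinom_succ, pow_succ 16] at h
    rw [show (2 * m + 1) / 2 = m by lia, pow_succ 4, pow_mul]
    norm_num
    nlinarith [sq_nonneg ((2 * m + 1).choose m)]

/-- For every `n ≥ 1`, `(n choose ⌊n/2⌋) ≤ 2·2^n/√n` over the reals. -/
theorem stmt19 (n : ℕ) (hn : 1 ≤ n) :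
    ((n.choose (n / 2) : ℕ) : ℝ) ≤ 2 * 2 ^ n / Real.sqrt n := by
  have hpos : 0 < Real.sqrt n := Real.sqrt_pos.2 (by exact_mod_cast hn)
  rw [le_div_iff₀ hpos]
  have hsq : (n : ℝ) * (n.choose (n / 2) : ℝ) ^ 2 ≤ 4 ^ n := by
    exact_mod_cast mul_choose_half_sq_le n
  have hle : (n.choose (n / 2) : ℝ) * Real.sqrt n ≤ 2 ^ n := by
    refine (sq_le_sq₀ (by positivity) (by positivity)).1 ?_
    rw [mul_pow, Real.sq_sqrt n.cast_nonneg, ← pow_mul, mul_comm n 2, pow_mul]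
    norm_num
    linarith
  linarith [pow_pos (two_pos : (0 : ℝ) < 2) n]
end
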